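/- arXiv:math/9909036 — 2 statements merged into one kernel-verified Lean document; each statement's English description precedes it below -/
import Mathlib

section
/- Let q ∈ (0,1) be real, let m, n be positive integers with m ≤ n, and set N = m+n. Suppose ⋆ : ℂ_q[SL_N] → ℂ_q[SL_N] is a conjugate-linear, additive, antimultiplicative map (⋆(λx) = conj(λ)·⋆(x), ⋆(x+y) = ⋆(x)+⋆(y), ⋆(xy) = ⋆(y)⋆(x), ⋆(1) = 1) satisfying ⋆(t_{ij}) = (−q)^{j−i} · t^{∧(N−1)}_{{1,…,N}∖{i}, {1,…,N}∖{j}} for all 1 ≤ i,j ≤ N. Then for every subset J ⊆ {1,…,N} with card(J) = m, writing J^c = {1,…,N}∖J and l(J) = card{(a,b) ∈ J × J^c : a > b}, one has ⋆(t^{∧m}_{{1,…,m}, J}) = (−q)^{l(J)} · t^{∧n}_{{m+1,…,N}, J^c}. -/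
/-!
Quantum matrix algebra `ℂ_q[Mat_N]`, quantum determinant, `ℂ_q[SL_N]`,
and quantum minors, following the conventions of the paper.
-/

noncomputable section

open scoped BigOperators

namespace QPaper

/-- Number of inversions of a permutation of `Fin k`. -/
def inversions {k : ℕ} (s : Equiv.Perm (Fin k)) : ℕ :=
  ((Finset.univ : Finset (Fin k × Fin k)).filter fun p => p.1 < p.2 ∧ s p.2 < s p.1).card

/-- The increasing enumeration of a finset of cardinality `k`. -/
def enum {α : Type*} [LinearOrder α] (J : Finset α) {k : ℕ} (h : J.card = k) : Fin k → α :=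
  fun i => (J.orderIsoOfFin h i : α)

/-- Defining relations of the quantum matrix algebra `ℂ_q[Mat_N]`. -/
inductive qMatRel (q : ℝ) (N : ℕ) :
    FreeAlgebra ℂ (Fin N × Fin N) → FreeAlgebra ℂ (Fin N × Fin N) → Prop
  | rowRel (i j l : Fin N) (h : j < l) :
      qMatRel q N (FreeAlgebra.ι ℂ (i, j) * FreeAlgebra.ι ℂ (i, l))
        ((q : ℂ) • (FreeAlgebra.ι ℂ (i, l) * FreeAlgebra.ι ℂ (i, j)))
  | colRel (i k j : Fin N) (h : i < k) :
      qMatRel q N (FreeAlgebra.ι ℂ (i, j) * FreeAlgebra.ι ℂ (k, j))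
        ((q : ℂ) • (FreeAlgebra.ι ℂ (k, j) * FreeAlgebra.ι ℂ (i, j)))
  | commRel (i k j l : Fin N) (h1 : i < k) (h2 : l < j) :
      qMatRel q N (FreeAlgebra.ι ℂ (i, j) * FreeAlgebra.ι ℂ (k, l))
        (FreeAlgebra.ι ℂ (k, l) * FreeAlgebra.ι ℂ (i, j))
  | qRel (i k j l : Fin N) (h1 : i < k) (h2 : j < l) :
      qMatRel q N
        (FreeAlgebra.ι ℂ (i, j) * FreeAlgebra.ι ℂ (k, l) -
          FreeAlgebra.ι ℂ (k, l) * FreeAlgebra.ι ℂ (i, j))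
        (((q : ℂ) - (q : ℂ)⁻¹) • (FreeAlgebra.ι ℂ (i, l) * FreeAlgebra.ι ℂ (k, j)))

/-- The quantum matrix algebra `ℂ_q[Mat_N]`. -/
abbrev QMat (q : ℝ) (N : ℕ) := RingQuot (qMatRel q N)

/-- The generators `t_{ij}` of `ℂ_q[Mat_N]` (`0`-based indices). -/
def T (q : ℝ) {N : ℕ} (i j : Fin N) : QMat q N :=
  RingQuot.mkAlgHom ℂ (qMatRel q N) (FreeAlgebra.ι ℂ (i, j))

/-- The quantum minor `t^{∧k}_{I,J}` of `ℂ_q[Mat_N]`, where the rows and columns are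
given by the enumerations `row` and `col`. -/
def qMinor (q : ℝ) {N k : ℕ} (row col : Fin k → Fin N) : QMat q N :=
  ∑ s : Equiv.Perm (Fin k),
    ((-(q : ℂ)) ^ inversions s) • (List.ofFn fun i => T q (row i) (col (s i))).prod

/-- The quantum determinant of `ℂ_q[Mat_N]`. -/
def qDet (q : ℝ) (N : ℕ) : QMat q N := qMinor q (id : Fin N → Fin N) id

/-- The relation `det_q T = 1`. -/
inductive qSLRel (q : ℝ) (N : ℕ) : QMat q N → QMat q N → Prop
  | det : qSLRel q N (qDet q N) 1

/-- The algebra `ℂ_q[SL_N]` of regular functions on the quantum group `SL_N`. -/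
abbrev QSL (q : ℝ) (N : ℕ) := RingQuot (qSLRel q N)

/-- The generators `t_{ij}` of `ℂ_q[SL_N]`. -/
def tSL (q : ℝ) {N : ℕ} (i j : Fin N) : QSL q N :=
  RingQuot.mkAlgHom ℂ (qSLRel q N) (T q i j)

/-- The quantum minor `t^{∧k}_{I,J}` in `ℂ_q[SL_N]`, where the rows and columns are
given by the enumerations `row` and `col`. -/
def sMinor (q : ℝ) {N k : ℕ} (row col : Fin k → Fin N) : QSL q N :=
  ∑ s : Equiv.Perm (Fin k),
    ((-(q : ℂ)) ^ inversions s) • (List.ofFn fun i => tSL q (row i) (col (s i))).prod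

/-- Rows `{1,…,m}` inside `{1,…,m+n}`. -/
def firstRows (m n : ℕ) : Fin m → Fin (m + n) := Fin.castLE (Nat.le_add_right m n)

/-- Rows `{m+1,…,N}` inside `{1,…,m+n}`. -/
def lastRows (m n : ℕ) : Fin n → Fin (m + n) := Fin.natAdd m

/-- Columns `{1,…,n}` inside `{1,…,m+n}`. -/
def firstCols (m n : ℕ) : Fin n → Fin (m + n) := Fin.castLE (Nat.le_add_left n m)

/-- Columns `{n+1,…,N}` inside `{1,…,m+n}`. -/
def lastCols (m n : ℕ) : Fin m → Fin (m + n) :=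
  fun i => Fin.cast (Nat.add_comm n m) (Fin.natAdd n i)


/-- Cardinality of the complement of a point in `{1,…,N}`. -/
theorem card_univ_erase {N : ℕ} (i : Fin N) :
    ((Finset.univ : Finset (Fin N)).erase i).card = N - 1 := by
  rw [Finset.card_erase_of_mem (Finset.mem_univ i), Finset.card_univ, Fintype.card_fin]

end QPaper

open QPaper

namespace QPaper

variable {ι B : Type*} [LinearOrder ι] [Ring B] [Algebra ℂ B]

/-- Number of inversions of a list. -/
def listInv : List ι → ℕ
  | [] => 0
  | a :: l => l.countP (· < a) + listInv l

theorem listInv_append (l₁ l₂ : List ι) :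
    listInv (l₁ ++ l₂) =
      listInv l₁ + listInv l₂ + (l₁.map fun a => l₂.countP (· < a)).sum := by
  induction l₁ with
  | nil => simp [listInv]
  | cons a l ih => simp [listInv, ih]; ring

theorem listInv_eq_zero {l : List ι} (h : l.Pairwise (· < ·)) : listInv l = 0 := by
  induction l with
  | nil => rfl
  | cons a l ih =>
    rw [List.pairwise_cons] at h
    simp only [listInv, ih h.2, add_zero, List.countP_eq_zero, decide_eq_true_eq, not_lt]
    exact fun b hb => (h.1 b hb).le

theorem countP_ofFn {k : ℕ} (c : Fin k → ι) (b : ι) :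
    (List.ofFn c).countP (· < b) = ∑ i : Fin k, if c i < b then 1 else 0 := by
  induction k with
  | zero => simp
  | succ k ih =>
    simp [List.ofFn_succ, List.countP_cons, ih, Fin.sum_univ_succ, add_comm, -Finset.sum_boole]

theorem listInv_ofFn {k : ℕ} (c : Fin k → ι) :
    listInv (List.ofFn c) =
      ((Finset.univ : Finset (Fin k × Fin k)).filter fun p => p.1 < p.2 ∧ c p.2 < c p.1).card := by
  induction k with
  | zero => simp [listInv]
  | succ k ih =>
    rw [List.ofFn_succ, listInv, ih, countP_ofFn]
    simp [Finset.card_filter, Fintype.sum_prod_type, Fin.sum_univ_succ, -Finset.sum_boole]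

theorem listInv_ofFn_comp {k : ℕ} {c : Fin k → ι} (hc : StrictMono c) (s : Equiv.Perm (Fin k)) :
    listInv (List.ofFn (c ∘ s)) = inversions s := by
  simp [listInv_ofFn, inversions, hc.lt_iff_lt]

theorem pairwise_ofFn {k : ℕ} {c : Fin k → ι} (hc : StrictMono c) :
    (List.ofFn c).Pairwise (· < ·) :=
  List.pairwise_ofFn.2 fun _ _ h => hc h

/-- Elements satisfying the relations of the generators of a quantum exterior algebra. -/
structure QExt (p : ℂ) (x : ι → B) : Prop where
  sq (i : ι) : x i * x i = 0
  anti (i j : ι) (h : i < j) : x j * x i = p • (x i * x j)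

namespace QExt

variable {p : ℂ} {x : ι → B}

theorem mul_prod_eq_zero (hx : QExt p x) (hp : p ≠ 0) {a : ι} {l : List ι} (h : a ∈ l) :
    x a * (l.map x).prod = 0 := by
  induction l with
  | nil => simp at h
  | cons b l ih =>
    rw [List.map_cons, List.prod_cons, ← mul_assoc]
    rcases lt_trichotomy a b with hab | rfl | hab
    · have h' : x a * x b = p⁻¹ • (x b * x a) := by
        rw [hx.anti a b hab, smul_smul, inv_mul_cancel₀ hp, one_smul]
      rw [h', smul_mul_assoc, mul_assoc, ih ((List.mem_cons.1 h).resolve_left hab.ne)]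
      simp
    · rw [hx.sq, zero_mul]
    · rw [hx.anti b a hab, smul_mul_assoc, mul_assoc,
        ih ((List.mem_cons.1 h).resolve_left hab.ne')]
      simp

theorem prod_eq_zero (hx : QExt p x) (hp : p ≠ 0) {l : List ι} (h : ¬ l.Nodup) :
    (l.map x).prod = 0 := by
  induction l with
  | nil => simp at h
  | cons a l ih =>
    rw [List.map_cons, List.prod_cons]
    by_cases ha : a ∈ l
    · exact hx.mul_prod_eq_zero hp ha
    · rw [ih fun hl => h (List.nodup_cons.2 ⟨ha, hl⟩), mul_zero]

theorem mul_prod_append (hx : QExt p x) {a : ι} {l : List ι} (b : B) (h : ∀ i ∈ l, i < a) :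
    x a * ((l.map x).prod * b) = p ^ l.length • ((l.map x).prod * (x a * b)) := by
  induction l with
  | nil => simp
  | cons i l ih =>
    rw [List.forall_mem_cons] at h
    rw [List.map_cons, List.prod_cons, mul_assoc, ← mul_assoc (x a), hx.anti i a h.1,
      smul_mul_assoc, mul_assoc, ih h.2, List.length_cons, pow_succ', mul_smul, mul_smul_comm,
      mul_assoc]

theorem prod_eq_of_perm (hx : QExt p x) {l l' : List ι} (h : l.Perm l')
    (hl' : l'.Pairwise (· < ·)) : (l.map x).prod = p ^ listInv l • (l'.map x).prod := by
  induction l generalizing l' with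
  | nil => simp [List.nil_perm.1 h, listInv]
  | cons a l ih =>
    obtain ⟨l₁, l₂, rfl⟩ := List.append_of_mem (h.subset List.mem_cons_self)
    have hl : l.Perm (l₁ ++ l₂) := (List.perm_cons a).1 (h.trans List.perm_middle)
    rw [List.pairwise_append, List.pairwise_cons] at hl'
    obtain ⟨h₁, ⟨h₂, h₃⟩, h₄⟩ := hl'
    have hlt : ∀ i ∈ l₁, i < a := fun i hi => h₄ i hi a List.mem_cons_self
    have hc : l.countP (· < a) = l₁.length := by
      rw [hl.countP_eq, List.countP_append, List.countP_eq_length.2 (by simpa using hlt),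
        List.countP_eq_zero.2 (by simpa using fun i hi => (h₂ i hi).le), add_zero]
    rw [List.map_cons, List.prod_cons, ih hl (List.pairwise_append.2
      ⟨h₁, h₃, fun i hi j hj => h₄ i hi j (List.mem_cons_of_mem _ hj)⟩), listInv, hc,
      List.map_append, List.prod_append, mul_smul_comm, hx.mul_prod_append _ hlt, smul_smul,
      List.map_append, List.prod_append, List.map_cons, List.prod_cons, pow_add, mul_comm]

theorem prod_ofFn_comp (hx : QExt p x) {k : ℕ} {c : Fin k → ι} (hc : StrictMono c)
    (s : Equiv.Perm (Fin k)) :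
    (List.ofFn fun i => x (c (s i))).prod = p ^ inversions s • (List.ofFn fun i => x (c i)).prod := by
  have h := hx.prod_eq_of_perm (Equiv.Perm.ofFn_comp_perm s c) (pairwise_ofFn hc)
  rw [listInv_ofFn_comp hc, List.map_ofFn, List.map_ofFn] at h
  exact h

/-- A sum over all words of length `k`, flanked by two fixed words covering the complement of an
increasing word `c`, is supported on the rearrangements of `c`. -/
theorem sum_words [Fintype ι] (hx : QExt p x) (hp : p ≠ 0) {k : ℕ} {c : Fin k → ι}
    (hc : StrictMono c) {l₁ l₂ : List ι} (hl : ∀ a, a ∉ Set.range c → a ∈ l₁ ∨ a ∈ l₂)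
    (Φ : (Fin k → ι) → B →ₗ[ℂ] B) :
    ∑ d : Fin k → ι, Φ d ((l₁.map x).prod * (List.ofFn fun i => x (d i)).prod * (l₂.map x).prod) =
      ∑ s : Equiv.Perm (Fin k), p ^ inversions s • Φ (c ∘ s)
        ((l₁.map x).prod * (List.ofFn fun i => x (c i)).prod * (l₂.map x).prod) := by
  have hinj : Function.Injective fun s : Equiv.Perm (Fin k) => c ∘ s := fun s s' h =>
    Equiv.ext fun i => hc.injective (congrFun h i)
  refine (Finset.sum_subset (Finset.subset_univ (Finset.univ.map ⟨_, hinj⟩)) ?_).symm.trans ?_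
  · intro d _ hd
    suffices h : ¬ (l₁ ++ List.ofFn d ++ l₂).Nodup by
      have := hx.prod_eq_zero hp h
      rw [List.map_append, List.map_append, List.prod_append, List.prod_append,
        List.map_ofFn] at this
      simp only [Function.comp_def] at this
      rw [this, map_zero]
    intro h
    rw [List.nodup_append, List.nodup_append, List.nodup_ofFn] at h
    obtain ⟨⟨-, hd', h₁⟩, -, h₂⟩ := h
    have hr : ∀ i, d i ∈ Set.range c := by
      intro i
      by_contra hi
      rcases hl _ hi with h | h
      · exact h₁ _ h _ (List.mem_ofFn.2 ⟨i, rfl⟩) rfl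
      · exact h₂ _ (List.mem_append_right _ (List.mem_ofFn.2 ⟨i, rfl⟩)) _ h rfl
    choose s hs using hr
    have hs' : Function.Injective s := fun i j hij => hd' (by rw [← hs, ← hs, hij])
    refine hd (Finset.mem_map.2 ⟨Equiv.ofBijective s (Finite.injective_iff_bijective.1 hs'),
      Finset.mem_univ _, funext hs⟩)
  · rw [Finset.sum_map]
    refine Finset.sum_congr rfl fun s _ => ?_
    simp only [Function.Embedding.coeFn_mk, Function.comp_apply]
    rw [hx.prod_ofFn_comp hc, mul_smul_comm, smul_mul_assoc, map_smul]

end QExt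

/-- Fermionic creation operators with coefficients in an algebra. -/
theorem exists_qExt (A : Type*) [Ring A] [Algebra ℂ A] (p : ℂ) (N : ℕ) :
    ∃ (L : A →ₐ[ℂ] Module.End ℂ (Finset (Fin N) → A))
      (e : Fin N → Module.End ℂ (Finset (Fin N) → A)),
      QExt p e ∧ (∀ a i, Commute (L a) (e i)) ∧
        ∀ a b, L a * (List.ofFn e).prod = L b * (List.ofFn e).prod → a = b := by
  let e : Fin N → Module.End ℂ (Finset (Fin N) → A) := fun j =>
    { toFun := fun v J => if j ∈ J then p ^ (J.filter (· < j)).card • v (J.erase j) else 0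
      map_add' := fun v w => by ext J; by_cases h : j ∈ J <;> simp [h]
      map_smul' := fun c v => by ext J; by_cases h : j ∈ J <;> simp [h, smul_comm c] }
  have he : ∀ j v J, e j v J = if j ∈ J then p ^ (J.filter (· < j)).card • v (J.erase j) else 0 :=
    fun _ _ _ => rfl
  refine ⟨Algebra.lsmul ℂ ℂ _, e, ⟨?_, ?_⟩, ?_, ?_⟩
  · intro i
    ext1 v
    ext J
    simp [he]
  · intro i j hij
    refine LinearMap.ext fun v => funext fun J => ?_
    simp only [Module.End.mul_apply, LinearMap.smul_apply, Pi.smul_apply, he, Finset.mem_erase]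
    by_cases hi : i ∈ J <;> by_cases hj : j ∈ J <;> simp [hi, hj, hij.ne, hij.ne']
    rw [Finset.erase_right_comm]
    have h₁ : (J.filter (· < j)).card = ((J.erase i).filter (· < j)).card + 1 := by
      rw [Finset.filter_erase, Finset.card_erase_add_one]
      simp [hi, hij]
    have h₂ : ((J.erase j).filter (· < i)) = J.filter (· < i) := by
      rw [Finset.filter_erase, Finset.erase_eq_of_notMem]
      simp [hij.le]
    rw [h₁, h₂, smul_smul, smul_smul, smul_smul]
    congr 1
    ring
  · intro a i
    refine LinearMap.ext fun v => funext fun J => ?_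
    by_cases hi : i ∈ J <;> simp [he, hi]
  · intro a b h
    let v : Finset (Fin N) → A := fun J => if J = ∅ then 1 else 0
    have key : ∀ l : List (Fin N), l.Pairwise (· < ·) → ((l.map e).prod v) l.toFinset = 1 := by
      intro l hl
      induction l with
      | nil => simp [v]
      | cons a l ih =>
        rw [List.pairwise_cons] at hl
        have ha : a ∉ l.toFinset := fun h => (hl.1 a (List.mem_toFinset.1 h)).false
        have hf : (insert a l.toFinset).filter (· < a) = ∅ := by
          ext i
          simp only [Finset.mem_filter, Finset.mem_insert, List.mem_toFinset,
            Finset.notMem_empty, iff_false, not_and, not_lt]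
          rintro (rfl | h)
          · exact le_rfl
          · exact (hl.1 i h).le
        rw [List.map_cons, List.prod_cons, Module.End.mul_apply, he, List.toFinset_cons, hf,
          Finset.erase_insert ha, ih hl.2]
        simp
    have hk := key (List.ofFn id) (pairwise_ofFn strictMono_id)
    rw [List.map_ofFn, Function.comp_id] at hk
    have := congrFun (LinearMap.congr_fun h v) (List.ofFn id).toFinset
    simpa [hk] using this
/-- The defining relations of the generators of the quantum matrix algebra. -/
structure IsQMatrix {A : Type*} [Ring A] [Algebra ℂ A] (q : ℂ) (t : ι → ι → A) : Prop where
  row (i j l : ι) (h : j < l) : t i j * t i l = q • (t i l * t i j)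
  col (i k j : ι) (h : i < k) : t i j * t k j = q • (t k j * t i j)
  comm (i k j l : ι) (h : i < k) (h' : l < j) : t i j * t k l = t k l * t i j
  cross (i k j l : ι) (h : i < k) (h' : j < l) :
    t i j * t k l - t k l * t i j = (q - q⁻¹) • (t i l * t k j)

/-- The quantum minor of a matrix with entries in an algebra, expanded along rows. -/
def minor {A : Type*} [Ring A] [Algebra ℂ A] (p : ℂ) (t : ι → ι → A) {k : ℕ}
    (r c : Fin k → ι) : A :=
  ∑ s : Equiv.Perm (Fin k), p ^ inversions s • (List.ofFn fun i => t (r i) (c (s i))).prod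

theorem prod_ofFn_sum {ι R : Type*} [Semiring R] [Fintype ι] {k : ℕ} (f : Fin k → ι → R) :
    (List.ofFn fun i => ∑ j, f i j).prod =
      ∑ c : Fin k → ι, (List.ofFn fun i => f i (c i)).prod := by
  induction k with
  | zero => simp
  | succ k ih =>
    rw [List.ofFn_succ, List.prod_cons, ih, ← (Fin.consEquiv fun _ => ι).sum_comp,
      Fintype.sum_prod_type, Finset.sum_mul_sum]
    simp [Fin.consEquiv, List.ofFn_succ]

section Coaction

variable {A : Type*} [Ring A] [Algebra ℂ A] {q : ℂ} {t : ι → ι → A} {L : A →ₐ[ℂ] B} {e : ι → B}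

theorem prod_ofFn_mul {ι : Type*} {e : ι → B} (hcomm : ∀ a i, Commute (L a) (e i)) {k : ℕ} (a : Fin k → A)
    (c : Fin k → ι) :
    (List.ofFn fun i => L (a i) * e (c i)).prod =
      L (List.ofFn a).prod * (List.ofFn fun i => e (c i)).prod := by
  induction k with
  | zero => simp
  | succ k ih =>
    simp only [List.ofFn_succ, List.prod_cons, ih, map_mul, mul_assoc]
    congr 1
    rw [← mul_assoc, ← mul_assoc, (hcomm _ _).eq]

theorem commute_prod_map {ι : Type*} {e : ι → B} (hcomm : ∀ a i, Commute (L a) (e i)) (a : A)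
    (l : List ι) :
    Commute (L a) (l.map e).prod :=
  Commute.list_prod_right _ _ fun x hx => by
    obtain ⟨i, -, rfl⟩ := List.mem_map.1 hx
    exact hcomm a i

theorem IsQMatrix.transpose (ht : IsQMatrix q t) : IsQMatrix q fun i j => t j i where
  row i j l h := ht.col j l i h
  col i k j h := ht.row j i k h
  comm i k j l h h' := (ht.comm l j k i h' h).symm
  cross i k j l h h' := by
    rw [ht.cross j l i k h' h, ht.comm j l k i h' h]

theorem IsQMatrix.submatrix (ht : IsQMatrix q t) {κ : Type*} [LinearOrder κ] {r c : κ → ι}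
    (hr : StrictMono r) (hc : StrictMono c) : IsQMatrix q fun i j => t (r i) (c j) where
  row _ _ _ h := ht.row _ _ _ (hc h)
  col _ _ _ h := ht.col _ _ _ (hr h)
  comm _ _ _ _ h h' := ht.comm _ _ _ _ (hr h) (hc h')
  cross _ _ _ _ h h' := ht.cross _ _ _ _ (hr h) (hc h')

variable [Fintype ι]

/-- The coaction of a quantum matrix on a quantum exterior algebra preserves the relations. -/
theorem QExt.coaction (hq : q ≠ 0) (he : QExt (-q) e) (hcomm : ∀ a i, Commute (L a) (e i))
    (ht : IsQMatrix q t) : QExt (-q) fun i => ∑ j, L (t i j) * e j := by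
  have hmul : ∀ i k, (∑ j, L (t i j) * e j) * (∑ j, L (t k j) * e j) =
      ∑ j, ∑ l, L (t i j * t k l) * (e j * e l) := by
    intro i k
    rw [Finset.sum_mul_sum]
    refine Finset.sum_congr rfl fun j _ => Finset.sum_congr rfl fun l _ => ?_
    rw [map_mul, mul_assoc, mul_assoc, ← mul_assoc (e j), ← (hcomm _ _).eq, mul_assoc]
  have hzero : ∀ G : ι → ι → A, (∀ j l, j < l → G j l = q • G l j) →
      ∑ j, ∑ l, L (G j l) * (e j * e l) = 0 := by
    intro G hG
    have hlt : ∀ j l, j < l →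
        L (G j l) * (e j * e l) + L (G l j) * (e l * e j) = 0 := by
      intro j l h
      rw [hG j l h, he.anti j l h, map_smul, smul_mul_assoc, mul_smul_comm, neg_smul,
        add_neg_cancel]
    have h2 : ∑ j, ∑ l, L (G j l) * (e j * e l) + ∑ j, ∑ l, L (G j l) * (e j * e l) = 0 := by
      nth_rw 2 [Finset.sum_comm]
      simp only [← Finset.sum_add_distrib]
      refine Finset.sum_eq_zero fun j _ => Finset.sum_eq_zero fun l _ => ?_
      rcases lt_trichotomy j l with h | rfl | h
      · exact hlt j l h
      · simp [he.sq]
      · rw [add_comm]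
        exact hlt l j h
    rw [← two_smul ℂ] at h2
    exact (smul_eq_zero.1 h2).resolve_left two_ne_zero
  refine ⟨fun i => ?_, fun i k hik => ?_⟩
  · rw [hmul]
    exact hzero (fun j l => t i j * t i l) fun j l h => ht.row i j l h
  · rw [← sub_eq_zero, hmul, hmul, Finset.smul_sum, ← Finset.sum_sub_distrib]
    refine Eq.trans ?_ (hzero (fun j l => t k j * t i l + q • (t i j * t k l)) fun j l h => ?_)
    · refine Finset.sum_congr rfl fun j _ => ?_
      rw [Finset.smul_sum, ← Finset.sum_sub_distrib]
      refine Finset.sum_congr rfl fun l _ => ?_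
      rw [map_add, add_mul, map_smul, smul_mul_assoc, neg_smul, sub_neg_eq_add]
    · have h₁ := ht.comm i k l j hik h
      have h₂ : t i j * t k l = t k l * t i j + (q - q⁻¹) • (t i l * t k j) := by
        rw [← ht.cross i k j l hik h, add_sub_cancel]
      rw [h₂, ← h₁]
      simp only [smul_add, smul_smul, mul_sub, mul_inv_cancel₀ hq]
      module

/-- Laplace-type expansion: a product of coacted generators flanked by two fixed words. -/
theorem QExt.words_mul_coaction (hq : q ≠ 0) (he : QExt (-q) e)
    (hcomm : ∀ a i, Commute (L a) (e i)) {k : ℕ} (r : Fin k → ι) {c : Fin k → ι}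
    (hc : StrictMono c) {l₁ l₂ : List ι} (hl : ∀ a, a ∉ Set.range c → a ∈ l₁ ∨ a ∈ l₂) :
    (l₁.map e).prod * (List.ofFn fun i => ∑ j, L (t (r i) j) * e j).prod * (l₂.map e).prod =
      L (minor (-q) t r c) * ((l₁ ++ List.ofFn c ++ l₂).map e).prod := by
  have h := he.sum_words (neg_ne_zero.2 hq) hc hl fun d =>
    LinearMap.mulLeft ℂ (L (List.ofFn fun i => t (r i) (d i)).prod)
  rw [prod_ofFn_sum, Finset.mul_sum, Finset.sum_mul]
  simp only [LinearMap.mulLeft_apply, Function.comp_apply] at h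
  rw [minor, map_sum, Finset.sum_mul]
  refine Eq.trans (Finset.sum_congr rfl fun d _ => ?_) (h.trans (Finset.sum_congr rfl fun s _ => ?_))
  · rw [prod_ofFn_mul hcomm (fun i => t (r i) (d i)), ← mul_assoc, ← mul_assoc, ← mul_assoc,
      (commute_prod_map hcomm _ _).eq]
  · rw [map_smul, smul_mul_assoc, List.map_append, List.map_append, List.prod_append,
      List.prod_append, List.map_ofFn]
    rfl

end Coaction

section QMatrix

variable {A : Type*} [Ring A] [Algebra ℂ A] {q : ℝ} {N : ℕ} {t : Fin N → Fin N → A}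

theorem minor_id_comp_perm (hq : 0 < q) (ht : IsQMatrix (q : ℂ) t) (s : Equiv.Perm (Fin N)) :
    minor (-(q : ℂ)) t s id = (-(q : ℂ)) ^ inversions s • minor (-(q : ℂ)) t id id := by
  have hq' : (q : ℂ) ≠ 0 := by exact_mod_cast hq.ne'
  obtain ⟨L, e, he, hcomm, hinj⟩ := exists_qExt A (-(q : ℂ)) N
  have hw := fun r : Fin N → Fin N => he.words_mul_coaction (t := t) hq' hcomm r strictMono_id
    (l₁ := []) (l₂ := []) (by simp)
  simp only [List.map_nil, List.prod_nil, one_mul, mul_one, List.nil_append, List.append_nil,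
    List.map_ofFn, Function.comp_id] at hw
  have hE := (he.coaction hq' hcomm ht).prod_ofFn_comp strictMono_id s
  simp only [id] at hE
  apply hinj
  rw [← hw, hE, map_smul, smul_mul_assoc, ← hw]
  rfl

theorem sum_sq_ne_zero (k : ℕ) (hq : 0 < q) :
    ∑ s : Equiv.Perm (Fin k), (-(q : ℂ)) ^ inversions s * (-(q : ℂ)) ^ inversions s ≠ 0 := by
  have h : 0 < ∑ s : Equiv.Perm (Fin k), (-q) ^ inversions s * (-q) ^ inversions s :=
    Finset.sum_pos (fun s _ => mul_self_pos.2 (pow_ne_zero _ (neg_ne_zero.2 hq.ne')))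
      Finset.univ_nonempty
  exact_mod_cast h.ne'

/-- The row and the column expansions of the quantum determinant agree. -/
theorem minor_id_transpose (hq : 0 < q) (ht : IsQMatrix (q : ℂ) t) :
    minor (-(q : ℂ)) (fun i j => t j i) id id = minor (-(q : ℂ)) t id id := by
  have key : ∀ u : Fin N → Fin N → A, IsQMatrix (q : ℂ) u →
      (∑ s : Equiv.Perm (Fin N), (-(q : ℂ)) ^ inversions s * (-(q : ℂ)) ^ inversions s) •
        minor (-(q : ℂ)) u id id =
      ∑ s : Equiv.Perm (Fin N), ∑ s' : Equiv.Perm (Fin N),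
        ((-(q : ℂ)) ^ inversions s * (-(q : ℂ)) ^ inversions s') •
          (List.ofFn fun i => u (s i) (s' i)).prod := by
    intro u hu
    rw [Finset.sum_smul]
    refine Finset.sum_congr rfl fun s _ => ?_
    rw [mul_smul, ← minor_id_comp_perm hq hu, minor, Finset.smul_sum]
    simp only [smul_smul, id]
  refine smul_right_injective A (sum_sq_ne_zero N hq) ?_
  dsimp only
  rw [key _ ht.transpose, key t ht, Finset.sum_comm]
  simp only [mul_comm]

theorem minor_transpose {ι : Type*} [LinearOrder ι] {t : ι → ι → A} (hq : 0 < q)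
    (ht : IsQMatrix (q : ℂ) t) {k : ℕ} {r c : Fin k → ι} (hr : StrictMono r) (hc : StrictMono c) :
    minor (-(q : ℂ)) (fun i j => t j i) c r = minor (-(q : ℂ)) t r c :=
  minor_id_transpose hq (ht.submatrix hr hc)

end QMatrix

theorem strictMono_enum {J : Finset ι} {k : ℕ} (h : J.card = k) : StrictMono (enum J h) :=
  fun _ _ hij => (J.orderIsoOfFin h).strictMono hij

theorem range_enum {J : Finset ι} {k : ℕ} (h : J.card = k) : Set.range (enum J h) = J := by
  ext a
  refine ⟨?_, fun ha => ⟨(J.orderIsoOfFin h).symm ⟨a, ha⟩, by simp [enum]⟩⟩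
  rintro ⟨i, rfl⟩
  exact (J.orderIsoOfFin h i).2

theorem perm_ofFn_id {N : ℕ} {l : List (Fin N)} (hl : l.Nodup) (h : ∀ a, a ∈ l) :
    l.Perm (List.ofFn id) :=
  (List.perm_ext_iff_of_nodup hl (List.nodup_ofFn.2 Function.injective_id)).2 fun a => by
    simp [h]

section Inverse

variable {A : Type*} [Ring A] [Algebra ℂ A] {q : ℝ} {N : ℕ} {t : Fin N → Fin N → A}

theorem listInv_cons_ofFn {k : ℕ} {i : Fin N} {c : Fin k → Fin N} (hc : StrictMono c)
    (hl : (i :: List.ofFn c).Perm (List.ofFn id)) : listInv (i :: List.ofFn c) = i := by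
  have h := hl.countP_eq (· < i)
  rw [List.countP_cons, countP_ofFn id] at h
  rw [listInv, listInv_eq_zero (pairwise_ofFn hc)]
  simpa [Finset.filter_gt_eq_Iio] using h

theorem QExt.prod_coaction {B : Type*} [Ring B] [Algebra ℂ B] {L : A →ₐ[ℂ] B} {e : Fin N → B}
    {q : ℂ} (hq : q ≠ 0) (he : QExt (-q) e) (hcomm : ∀ a i, Commute (L a) (e i)) :
    (List.ofFn fun i => ∑ j, L (t i j) * e j).prod =
      L (minor (-q) t id id) * (List.ofFn e).prod := by
  simpa [List.map_ofFn] using he.words_mul_coaction (t := t) hq hcomm id strictMono_id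
    (l₁ := []) (l₂ := []) (by simp)

/-- Expansion of the quantum determinant along a row. -/
theorem sum_mul_minor (hq : 0 < q) (ht : IsQMatrix (q : ℂ) t) {M : ℕ}
    {c : Fin N → Fin M → Fin N} (hc : ∀ k, StrictMono (c k))
    (hr : ∀ k, Set.range (c k) = {k}ᶜ) (i k : Fin N) :
    ∑ j : Fin N, (-(q : ℂ)) ^ (j : ℕ) • (t i j * minor (-(q : ℂ)) t (c k) (c j)) =
      if i = k then (-(q : ℂ)) ^ (k : ℕ) • minor (-(q : ℂ)) t id id else 0 := by
  have hq' : (q : ℂ) ≠ 0 := by exact_mod_cast hq.ne'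
  obtain ⟨L, e, he, hcomm, hinj⟩ := exists_qExt A (-(q : ℂ)) N
  have hmem : ∀ k a, a ∈ List.ofFn (c k) ↔ a ≠ k := fun k a => by
    rw [List.mem_ofFn, ← Set.mem_range, hr]
    rfl
  have hperm : ∀ k, (k :: List.ofFn (c k)).Perm (List.ofFn id) := fun k =>
    perm_ofFn_id (List.nodup_cons.2 ⟨by simp [hmem], List.nodup_ofFn.2 (hc k).injective⟩)
      fun a => by
        rw [List.mem_cons, hmem]
        exact em _
  have hE := he.coaction hq' hcomm ht
  apply hinj
  have hleft : ∀ j, e j * (List.ofFn fun i => ∑ l, L (t (c k i) l) * e l).prod =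
      L (minor (-(q : ℂ)) t (c k) (c j)) * ((-(q : ℂ)) ^ (j : ℕ) • (List.ofFn e).prod) := by
    intro j
    have h := he.words_mul_coaction (t := t) hq' hcomm (c k) (hc j) (l₁ := [j]) (l₂ := [])
      (fun a ha => by simpa [hr] using ha)
    rw [List.append_nil, List.singleton_append, he.prod_eq_of_perm (hperm j)
      (pairwise_ofFn strictMono_id), listInv_cons_ofFn (hc j) (hperm j), List.map_ofFn,
      Function.comp_id] at h
    simpa using h
  trans ((i :: List.ofFn (c k)).map fun i => ∑ j, L (t i j) * e j).prod
  · rw [List.map_cons, List.prod_cons, List.map_ofFn, Finset.sum_mul, map_sum, Finset.sum_mul]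
    refine Finset.sum_congr rfl fun j _ => ?_
    rw [mul_assoc]
    refine Eq.trans ?_ (congrArg (L (t i j) * ·) (hleft j).symm)
    simp [mul_assoc]
  · split_ifs with hik
    · subst hik
      rw [hE.prod_eq_of_perm (hperm i) (pairwise_ofFn strictMono_id),
        listInv_cons_ofFn (hc i) (hperm i), List.map_ofFn, Function.comp_id,
        he.prod_coaction hq' hcomm, map_smul, smul_mul_assoc]
    · rw [List.map_cons, List.prod_cons,
        hE.mul_prod_eq_zero (neg_ne_zero.2 hq') ((hmem k i).2 hik), map_zero, zero_mul]

variable {star : A → A}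

theorem prod_ofFn_star {ι B : Type*} [Fintype ι] [Ring B] [Algebra ℂ B] {L : A →ₐ[ℂ] B}
    {t : ι → ι → A} {f F : ι → B}
    (h_mul : ∀ x y, star (x * y) = star y * star x) (h_one : star 1 = 1)
    (hcomm : ∀ a i, Commute (L a) (f i)) (hf : ∀ k, f k = ∑ j, F j * L (star (t k j)))
    {k : ℕ} (r : Fin k → ι) :
    (List.ofFn fun i => f (r i)).prod = ∑ c : Fin k → ι,
      (List.ofFn fun i => F (c i)).prod * L (star (List.ofFn fun i => t (r i) (c i)).prod) := by
  induction k with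
  | zero => simp [h_one]
  | succ k ih =>
    have hc : ∀ a, Commute (L a) (List.ofFn fun i : Fin k => f (r i.succ)).prod := fun a =>
      Commute.list_prod_right _ _ fun x hx => by
        obtain ⟨i, rfl⟩ := List.mem_ofFn.1 hx
        exact hcomm a _
    rw [List.ofFn_succ, List.prod_cons, hf, Finset.sum_mul,
      ← (Fin.consEquiv fun _ => ι).sum_comp, Fintype.sum_prod_type]
    refine Finset.sum_congr rfl fun j _ => ?_
    rw [mul_assoc, (hc _).eq, ih, Finset.sum_mul, Finset.mul_sum]
    refine Finset.sum_congr rfl fun c _ => ?_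
    simp [Fin.consEquiv, List.ofFn_succ, h_mul, mul_assoc]

/-- A conjugate-linear antimultiplicative map sending a quantum matrix of determinant one to its
transposed inverse sends each quantum minor to the complementary one, up to a power of `-q`. -/
theorem star_minor (hq : 0 < q) (ht : IsQMatrix (q : ℂ) t)
    (hdet : minor (-(q : ℂ)) t id id = 1)
    (h_add : ∀ x y, star (x + y) = star x + star y)
    (h_smul : ∀ (c : ℂ) (x), star (c • x) = (starRingEnd ℂ c) • star x)
    (h_mul : ∀ x y, star (x * y) = star y * star x) (h_one : star 1 = 1)
    (h_inv : ∀ i k, ∑ j, t i j * star (t k j) = if i = k then 1 else 0)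
    {m n : ℕ} {r₀ c₀ : Fin m → Fin N} {r₁ c₁ : Fin n → Fin N}
    (hr₀ : StrictMono r₀) (hc₀ : StrictMono c₀) (hr₁ : StrictMono r₁) (hc₁ : StrictMono c₁)
    (hr : Set.range r₀ = (Set.range r₁)ᶜ) (hc : Set.range c₀ = (Set.range c₁)ᶜ) :
    (-(q : ℂ)) ^ listInv (List.ofFn c₁ ++ List.ofFn c₀) • star (minor (-(q : ℂ)) t r₀ c₀) =
      (-(q : ℂ)) ^ listInv (List.ofFn r₁ ++ List.ofFn r₀) • minor (-(q : ℂ)) t r₁ c₁ := by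
  have hq' : (q : ℂ) ≠ 0 := by exact_mod_cast hq.ne'
  obtain ⟨L, f, hf, hcomm, hinj⟩ := exists_qExt A (-(q : ℂ)) N
  have hperm : ∀ {c₀ : Fin m → Fin N} {c₁ : Fin n → Fin N}, StrictMono c₀ → StrictMono c₁ →
      Set.range c₀ = (Set.range c₁)ᶜ →
      (List.ofFn c₁ ++ List.ofFn c₀).Perm (List.ofFn id) := by
    intro c₀ c₁ h₀ h₁ h
    have hmem : ∀ a, a ∈ List.ofFn c₀ ↔ a ∉ List.ofFn c₁ := fun a => by
      rw [List.mem_ofFn, List.mem_ofFn, ← Set.mem_range, h]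
      rfl
    refine perm_ofFn_id (List.nodup_append.2 ⟨List.nodup_ofFn.2 h₁.injective,
      List.nodup_ofFn.2 h₀.injective, ?_⟩) fun a => ?_
    · rintro a ha _ hb rfl
      exact (hmem a).1 hb ha
    · rw [List.mem_append, hmem]
      exact em _
  have hF := hf.coaction hq' hcomm ht.transpose
  set F : Fin N → _ := fun j => ∑ i, L (t i j) * f i with hFdef
  have hfF : ∀ k, f k = ∑ j, F j * L (star (t k j)) := by
    intro k
    simp only [hFdef, Finset.sum_mul]
    rw [Finset.sum_comm]
    have : ∀ i, ∑ j, L (t i j) * f i * L (star (t k j)) = if i = k then f k else 0 := by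
      intro i
      have h := congrArg (L · * f i) (h_inv i k)
      simp only [map_sum, map_mul, Finset.sum_mul] at h
      simp only [mul_assoc, ← (hcomm _ _).eq]
      simp only [mul_assoc] at h
      rw [h]
      split_ifs with hik <;> simp [hik]
    simp [this]
  have hstar : star (minor (-(q : ℂ)) t r₀ c₀) = ∑ s : Equiv.Perm (Fin m),
      (-(q : ℂ)) ^ inversions s • star (List.ofFn fun i => t (r₀ i) (c₀ (s i))).prod := by
    rw [minor]
    refine (map_sum (AddMonoidHom.mk' star h_add) _ _).trans
      (Finset.sum_congr rfl fun s _ => ?_)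
    simp [h_smul]
  have hdet' : (List.ofFn F).prod = (List.ofFn f).prod := by
    have h := hf.prod_coaction (t := fun i j => t j i) hq' hcomm
    rw [minor_id_transpose hq ht, hdet, map_one, one_mul] at h
    exact h
  have key : ((List.ofFn c₁).map F).prod * (List.ofFn fun i => f (r₀ i)).prod =
      ((List.ofFn c₁ ++ List.ofFn c₀).map F).prod * L (star (minor (-(q : ℂ)) t r₀ c₀)) := by
    rw [prod_ofFn_star h_mul h_one hcomm hfF, Finset.mul_sum]
    have h := hF.sum_words (neg_ne_zero.2 hq') hc₀ (l₁ := List.ofFn c₁) (l₂ := [])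
      (fun a ha => by simpa [hc] using ha)
      fun d => LinearMap.mulRight ℂ (L (star (List.ofFn fun i => t (r₀ i) (d i)).prod))
    simp only [List.map_nil, List.prod_nil, mul_one, LinearMap.mulRight_apply,
      Function.comp_apply, mul_assoc] at h
    rw [h, hstar, map_sum, Finset.mul_sum]
    refine Finset.sum_congr rfl fun s _ => ?_
    rw [map_smul, mul_smul_comm, List.map_append, List.prod_append, List.map_ofFn, List.map_ofFn,
      mul_assoc]
    rfl
  have hleft := hf.words_mul_coaction (t := fun i j => t j i) hq' hcomm c₁ hr₁
    (l₁ := []) (l₂ := List.ofFn r₀) (fun a ha => by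
      right
      rw [List.mem_ofFn, ← Set.mem_range, hr]
      exact ha)
  rw [List.map_nil, List.prod_nil, one_mul, List.nil_append,
    hf.prod_eq_of_perm (hperm hr₀ hr₁ hr) (pairwise_ofFn strictMono_id),
    minor_transpose hq ht hr₁ hc₁] at hleft
  rw [hF.prod_eq_of_perm (hperm hc₀ hc₁ hc) (pairwise_ofFn strictMono_id)] at key
  simp only [List.map_ofFn, Function.comp_def, id] at key hleft
  rw [hdet', smul_mul_assoc] at key
  have hc' : Commute (L (star (minor (-(q : ℂ)) t r₀ c₀))) (List.ofFn f).prod := by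
    have := commute_prod_map hcomm (star (minor (-(q : ℂ)) t r₀ c₀)) (List.ofFn id)
    rwa [List.map_ofFn, Function.comp_id] at this
  apply hinj
  rw [map_smul, map_smul, smul_mul_assoc, smul_mul_assoc, hc'.eq]
  exact key.symm.trans (hleft.trans (mul_smul_comm _ _ _))

end Inverse

theorem isQMatrix_T (q : ℝ) (N : ℕ) : IsQMatrix (q : ℂ) (T q : Fin N → Fin N → QMat q N) where
  row i j l h := by
    simpa [T, -Complex.coe_smul] using RingQuot.mkAlgHom_rel ℂ (qMatRel.rowRel (q := q) i j l h)
  col i k j h := by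
    simpa [T, -Complex.coe_smul] using RingQuot.mkAlgHom_rel ℂ (qMatRel.colRel (q := q) i k j h)
  comm i k j l h h' := by
    simpa [T, -Complex.coe_smul] using RingQuot.mkAlgHom_rel ℂ (qMatRel.commRel (q := q) i k j l h h')
  cross i k j l h h' := by
    simpa [T, -Complex.coe_smul] using RingQuot.mkAlgHom_rel ℂ (qMatRel.qRel (q := q) i k j l h h')

theorem IsQMatrix.map {A A' : Type*} [Ring A] [Algebra ℂ A] [Ring A'] [Algebra ℂ A'] {q : ℂ}
    {t : ι → ι → A} (ht : IsQMatrix q t) (f : A →ₐ[ℂ] A') :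
    IsQMatrix q fun i j => f (t i j) where
  row i j l h := by simpa using congrArg f (ht.row i j l h)
  col i k j h := by simpa using congrArg f (ht.col i k j h)
  comm i k j l h h' := by simpa using congrArg f (ht.comm i k j l h h')
  cross i k j l h h' := by simpa using congrArg f (ht.cross i k j l h h')

theorem sMinor_eq_minor (q : ℝ) {N k : ℕ} (r c : Fin k → Fin N) :
    sMinor q r c = minor (-(q : ℂ)) (tSL q) r c := rfl

theorem isQMatrix_tSL (q : ℝ) (N : ℕ) : IsQMatrix (q : ℂ) (tSL q : Fin N → Fin N → QSL q N) :=
  IsQMatrix.map (A' := QSL q N) (isQMatrix_T q N) (RingQuot.mkAlgHom ℂ (qSLRel q N))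

theorem minor_tSL_id (q : ℝ) (N : ℕ) :
    minor (-(q : ℂ)) (tSL q : Fin N → Fin N → QSL q N) id id = 1 := by
  have h := RingQuot.mkAlgHom_rel ℂ (qSLRel.det (q := q) (N := N))
  rw [map_one, qDet, qMinor, map_sum] at h
  rw [← h]
  refine Finset.sum_congr rfl fun s _ => ?_
  rw [map_smul, map_list_prod, List.map_ofFn]
  rfl

theorem countP_ofFn_enum {J : Finset ι} {k : ℕ} (h : J.card = k) (a : ι) :
    (List.ofFn (enum J h)).countP (· < a) = (J.filter (· < a)).card := by
  have hJ : J = Finset.univ.map ⟨enum J h, (strictMono_enum h).injective⟩ := by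
    rw [← Finset.coe_inj, Finset.coe_map, Finset.coe_univ, Set.image_univ]
    exact (range_enum h).symm
  rw [countP_ofFn]
  conv_rhs => rw [hJ, Finset.card_filter, Finset.sum_map]
  rfl

theorem listInv_enum_append {J K : Finset ι} {k l : ℕ} (hJ : J.card = k) (hK : K.card = l) :
    listInv (List.ofFn (enum K hK) ++ List.ofFn (enum J hJ)) =
      ((J ×ˢ K).filter fun p => p.1 < p.2).card := by
  have hK' : K = Finset.univ.map ⟨enum K hK, (strictMono_enum hK).injective⟩ := by
    rw [← Finset.coe_inj, Finset.coe_map, Finset.coe_univ, Set.image_univ]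
    exact (range_enum hK).symm
  rw [listInv_append, listInv_eq_zero (pairwise_ofFn (strictMono_enum hK)),
    listInv_eq_zero (pairwise_ofFn (strictMono_enum hJ)), Finset.card_filter,
    Finset.sum_product_right]
  simp only [countP_ofFn_enum, List.map_ofFn, List.sum_ofFn, zero_add, ← Finset.card_filter]
  conv_rhs => rw [hK', Finset.sum_map]
  rfl

end QPaper

/-- If `⋆` is a conjugate-linear antimultiplicative map on `ℂ_q[SL_N]`
(`N = m+n`) sending each generator `t_{ij}` to
`(−q)^{j−i} · t^{∧(N−1)}_{{1,…,N}∖{i},{1,…,N}∖{j}}`, then for every `J ⊆ {1,…,N}` with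
`card J = m` one has
`⋆(t^{∧m}_{{1,…,m},J}) = (−q)^{l(J)} · t^{∧n}_{{m+1,…,N},J^c}`, where
`l(J) = card {(a,b) ∈ J × J^c : a > b}`. -/
theorem star_qMinor (q : ℝ) (hq0 : 0 < q) (hq1 : q < 1)
    (m n : ℕ) (hm : 0 < m) (hn : 0 < n) (hmn : m ≤ n)
    (star : QSL q (m + n) → QSL q (m + n))
    (h_add : ∀ x y, star (x + y) = star x + star y)
    (h_smul : ∀ (c : ℂ) (x), star (c • x) = (starRingEnd ℂ c) • star x)
    (h_mul : ∀ x y, star (x * y) = star y * star x)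
    (h_one : star 1 = 1)
    (h_gen : ∀ i j : Fin (m + n),
      star (tSL q i j) =
        ((-(q : ℂ)) ^ ((j : ℤ) - (i : ℤ))) •
          sMinor q (enum ((Finset.univ : Finset (Fin (m + n))).erase i) (card_univ_erase i))
            (enum ((Finset.univ : Finset (Fin (m + n))).erase j) (card_univ_erase j)))
    (J : Finset (Fin (m + n))) (hJ : J.card = m) (hJc : Jᶜ.card = n) :
    star (sMinor q (firstRows m n) (enum J hJ)) =
      ((-(q : ℂ)) ^ (((J ×ˢ Jᶜ).filter fun p => p.2 < p.1).card)) •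
        sMinor q (lastRows m n) (enum Jᶜ hJc) := by
  have hq' : -(q : ℂ) ≠ 0 := neg_ne_zero.2 (by exact_mod_cast hq0.ne')
  have ht := isQMatrix_tSL q (m + n)
  have hdet := minor_tSL_id q (m + n)
  have h_inv : ∀ i k : Fin (m + n),
      ∑ j, tSL q i j * star (tSL q k j) = if i = k then 1 else 0 := by
    intro i k
    have h := sum_mul_minor hq0 ht (fun k => strictMono_enum (card_univ_erase k))
      (fun k => by rw [range_enum]; ext; simp) i k
    rw [hdet] at h
    have h' := congrArg ((-(q : ℂ)) ^ (-(k : ℤ)) • ·) h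
    simp only [Finset.smul_sum, smul_smul, ← zpow_natCast, ← zpow_add₀ hq', smul_ite,
      smul_zero, neg_add_cancel, zpow_zero, one_smul] at h'
    rw [← h']
    refine Finset.sum_congr rfl fun j _ => ?_
    rw [h_gen, mul_smul_comm, sMinor_eq_minor, sub_eq_neg_add]
  have hfirst : StrictMono (firstRows m n) := Fin.strictMono_castLE _
  have hlast : StrictMono (lastRows m n) := Fin.strictMono_natAdd m
  have hrows : Set.range (firstRows m n) = (Set.range (lastRows m n))ᶜ := by
    ext a
    induction a using Fin.addCases with
    | left i =>
      simp only [firstRows, lastRows, Set.mem_range, Set.mem_compl_iff, Fin.ext_iff,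
        Fin.val_natAdd, Fin.val_castAdd, Fin.val_castLE]
      exact iff_of_true ⟨i, rfl⟩ fun ⟨x, hx⟩ => by omega
    | right i => simp [firstRows, lastRows, Fin.ext_iff]
  have h := star_minor hq0 ht hdet h_add h_smul h_mul h_one h_inv hfirst (strictMono_enum hJ)
    hlast (strictMono_enum hJc) hrows (by simp [range_enum])
  have hinv : listInv (List.ofFn (lastRows m n) ++ List.ofFn (firstRows m n)) =
      ((J ×ˢ Jᶜ).filter fun p => p.1 < p.2).card +
        ((J ×ˢ Jᶜ).filter fun p => p.2 < p.1).card := by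
    have h₁ : ∀ a, (List.ofFn (firstRows m n)).countP (· < lastRows m n a) = m := fun a => by
      rw [countP_ofFn]
      simp [firstRows, lastRows, Fin.lt_def, Nat.lt_add_right]
    rw [listInv_append, listInv_eq_zero (pairwise_ofFn hlast),
      listInv_eq_zero (pairwise_ofFn hfirst), List.map_ofFn, List.sum_ofFn,
      ← Finset.card_union_of_disjoint, ← Finset.filter_or, Finset.filter_true_of_mem]
    · simp [h₁, hJ, hJc, mul_comm]
    · rintro ⟨a, b⟩ hab
      rw [Finset.mem_product, Finset.mem_compl] at hab
      exact lt_or_gt_of_ne fun h : a = b => hab.2 (h ▸ hab.1)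
    · exact Finset.disjoint_filter.2 fun p _ hp => hp.not_gt
  rw [listInv_enum_append hJ hJc, hinv, pow_add, mul_smul] at h
  exact smul_right_injective _ (pow_ne_zero _ hq') h
end
end

section
/- Let q ∈ (0,1) be real, let m, n be positive integers with m ≤ n, and set N = m+n. In ℂ_q[SL_N], the quantum minors t = t^{∧m}_{{1,…,m},{n+1,…,N}} and u = t^{∧n}_{{m+1,…,N},{1,…,n}} commute: t·u = u·t. -/
/-!
Quantum matrix algebra `ℂ_q[Mat_N]`, quantum determinant, `ℂ_q[SL_N]`,
and quantum minors, following the conventions of the paper.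
-/

noncomputable section

open scoped BigOperators

open QPaper

namespace QPaper

theorem T_commute (q : ℝ) {N : ℕ} {i k j l : Fin N} (hik : i < k) (hlj : l < j) :
    Commute (T q i j) (T q k l) := by
  simpa only [Commute, SemiconjBy, T, map_mul] using
    RingQuot.mkAlgHom_rel ℂ (qMatRel.commRel (q := q) i k j l hik hlj)

theorem tSL_commute (q : ℝ) {N : ℕ} {i k j l : Fin N} (hik : i < k) (hlj : l < j) :
    Commute (tSL q i j) (tSL q k l) :=
  (T_commute q hik hlj).map (RingQuot.mkAlgHom ℂ (qSLRel q N))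

/-- Two quantum minors commute if one lies strictly above and to the right of the other. -/
theorem sMinor_commute (q : ℝ) {N k l : ℕ} {row col : Fin k → Fin N} {row' col' : Fin l → Fin N}
    (hrow : ∀ a b, row a < row' b) (hcol : ∀ a b, col' b < col a) :
    Commute (sMinor q row col) (sMinor q row' col') := by
  refine Commute.sum_left _ _ _ fun s _ => Commute.sum_right _ _ _ fun s' _ => ?_
  refine Commute.smul_left (Commute.smul_right ?_ _) _
  refine Commute.list_prod_left _ _ fun x hx => Commute.list_prod_right _ _ fun y hy => ?_
  obtain ⟨a, rfl⟩ := (List.mem_ofFn' _ _).1 hx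
  obtain ⟨b, rfl⟩ := (List.mem_ofFn' _ _).1 hy
  exact tSL_commute q (hrow a b) (hcol _ _)

end QPaper

/-- In `ℂ_q[SL_N]` with `N = m + n`, the quantum minors
`t = t^{∧m}_{{1,…,m},{n+1,…,N}}` and `u = t^{∧n}_{{m+1,…,N},{1,…,n}}` commute. -/
theorem qMinor_t_comm_u (q : ℝ) (hq0 : 0 < q) (hq1 : q < 1)
    (m n : ℕ) (hm : 0 < m) (hn : 0 < n) (hmn : m ≤ n) :
    sMinor q (firstRows m n) (lastCols m n) * sMinor q (lastRows m n) (firstCols m n) =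
      sMinor q (lastRows m n) (firstCols m n) * sMinor q (firstRows m n) (lastCols m n) := by
  refine (sMinor_commute q (fun a b => ?_) fun a b => ?_).eq
  · simp only [firstRows, lastRows, Fin.lt_def, Fin.val_castLE, Fin.val_natAdd]
    omega
  · simp only [firstCols, lastCols, Fin.lt_def, Fin.val_castLE, Fin.val_cast, Fin.val_natAdd]
    omega
end
end
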